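/- arXiv:1912.02440 — 2 statements merged into one kernel-verified Lean document; each statement's English description precedes it below -/
import Mathlib

section
/- The monomials a^α b^β c^γ with α ≥ 1 and β, γ ≥ 0, together with the monomials d^δ b^β c^γ with δ, β, γ ≥ 0, form a basis of 𝒜 as a ℂ(q)-vector space. -/
noncomputable section

abbrev Kq : Type := RatFunc ℂ

/-- The indeterminate `q`. -/
noncomputable def qv : Kq := RatFunc.X

/-- Generators `a`, `b`, `c`, `d` of the algebra `𝒜 = ℒ_{0,1}(sl(2))`. -/
inductive AGen : Type
  | a | b | c | d

/-- The defining relations of `𝒜 = ℒ_{0,1}(sl(2))`. -/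
inductive ARel : FreeAlgebra Kq AGen → FreeAlgebra Kq AGen → Prop
  | ad_comm : ARel (FreeAlgebra.ι Kq AGen.a * FreeAlgebra.ι Kq AGen.d)
      (FreeAlgebra.ι Kq AGen.d * FreeAlgebra.ι Kq AGen.a)
  | db : ARel (FreeAlgebra.ι Kq AGen.d * FreeAlgebra.ι Kq AGen.b)
      ((qv ^ 2) • (FreeAlgebra.ι Kq AGen.b * FreeAlgebra.ι Kq AGen.d))
  | cd : ARel (FreeAlgebra.ι Kq AGen.c * FreeAlgebra.ι Kq AGen.d)
      ((qv ^ 2) • (FreeAlgebra.ι Kq AGen.d * FreeAlgebra.ι Kq AGen.c))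
  | ab : ARel (FreeAlgebra.ι Kq AGen.a * FreeAlgebra.ι Kq AGen.b
        - FreeAlgebra.ι Kq AGen.b * FreeAlgebra.ι Kq AGen.a)
      ((-(1 - qv⁻¹ ^ 2)) • (FreeAlgebra.ι Kq AGen.b * FreeAlgebra.ι Kq AGen.d))
  | cb : ARel (FreeAlgebra.ι Kq AGen.c * FreeAlgebra.ι Kq AGen.b
        - FreeAlgebra.ι Kq AGen.b * FreeAlgebra.ι Kq AGen.c)
      ((1 - qv⁻¹ ^ 2) • (FreeAlgebra.ι Kq AGen.d * FreeAlgebra.ι Kq AGen.a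
        - FreeAlgebra.ι Kq AGen.d * FreeAlgebra.ι Kq AGen.d))
  | ac : ARel (FreeAlgebra.ι Kq AGen.a * FreeAlgebra.ι Kq AGen.c
        - FreeAlgebra.ι Kq AGen.c * FreeAlgebra.ι Kq AGen.a)
      ((1 - qv⁻¹ ^ 2) • (FreeAlgebra.ι Kq AGen.d * FreeAlgebra.ι Kq AGen.c))
  | det : ARel (FreeAlgebra.ι Kq AGen.a * FreeAlgebra.ι Kq AGen.d
        - (qv ^ 2) • (FreeAlgebra.ι Kq AGen.b * FreeAlgebra.ι Kq AGen.c)) 1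

/-- The algebra `𝒜 = ℒ_{0,1}(sl(2))`, presented by generators and relations. -/
abbrev Aalg : Type := RingQuot ARel

noncomputable def aA : Aalg := RingQuot.mkAlgHom Kq ARel (FreeAlgebra.ι Kq AGen.a)
noncomputable def bA : Aalg := RingQuot.mkAlgHom Kq ARel (FreeAlgebra.ι Kq AGen.b)
noncomputable def cA : Aalg := RingQuot.mkAlgHom Kq ARel (FreeAlgebra.ι Kq AGen.c)
noncomputable def dA : Aalg := RingQuot.mkAlgHom Kq ARel (FreeAlgebra.ι Kq AGen.d)

/-- The element `ω = q a + q⁻¹ d`. -/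
noncomputable def ωA : Aalg := qv • aA + qv⁻¹ • dA

/-- The monomials `a^(α+1) b^β c^γ` (indexed by `Sum.inl (α, β, γ)`) and
`d^δ b^β c^γ` (indexed by `Sum.inr (δ, β, γ)`). -/
noncomputable def monA : (ℕ × ℕ × ℕ) ⊕ (ℕ × ℕ × ℕ) → Aalg
  | Sum.inl (α, β, γ) => aA ^ (α + 1) * bA ^ β * cA ^ γ
  | Sum.inr (δ, β, γ) => dA ^ δ * bA ^ β * cA ^ γ

namespace LoopAlg

/-! ### A representation of `𝒜` on the localisation at `d`

The space `(ℤ × ℕ × ℕ) →₀ F` has the basis `e (n, β, γ)`, which stands for `d ^ n * b ^ β * c ^ γ`. -/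

section Representation

variable {F : Type*} [Field F] (q : F)

/-- The basis vector standing for `d ^ n * b ^ β * c ^ γ`. -/
def e (i : ℤ × ℕ × ℕ) : (ℤ × ℕ × ℕ) →₀ F := Finsupp.single i 1

/-- The action of `a`. -/
def opA : Module.End F ((ℤ × ℕ × ℕ) →₀ F) :=
  Finsupp.linearCombination F fun i =>
    q ^ (2 * i.2.1) • e (i.1 - 1, i.2.1, i.2.2)
      + q ^ (2 * i.2.1 + 2) • e (i.1 - 1, i.2.1 + 1, i.2.2 + 1)
      - (q⁻¹ ^ 2 * (1 - q⁻¹ ^ (2 * i.2.1))) • e (i.1 + 1, i.2.1, i.2.2)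

/-- The action of `b`. -/
def opB : Module.End F ((ℤ × ℕ × ℕ) →₀ F) :=
  Finsupp.linearCombination F fun i => (q ^ i.1)⁻¹ ^ 2 • e (i.1, i.2.1 + 1, i.2.2)

/-- The value of the action of `c` on a basis vector. -/
def opCVal : ℤ × ℕ × ℕ → ((ℤ × ℕ × ℕ) →₀ F)
  | (n, 0, γ) => (q ^ n) ^ 2 • e (n, 0, γ + 1)
  | (n, β + 1, γ) => (q ^ n) ^ 2 • (q ^ (2 * β + 2) • e (n, β + 1, γ + 1)
      + (q⁻¹ ^ 2 * (q ^ (2 * β + 2) - 1)) • e (n, β, γ)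
      - (1 - q⁻¹ ^ (2 * β + 2)) • e (n + 2, β, γ))

/-- The action of `c`. -/
def opC : Module.End F ((ℤ × ℕ × ℕ) →₀ F) := Finsupp.linearCombination F (opCVal q)

/-- The action of `d`. -/
def opD : Module.End F ((ℤ × ℕ × ℕ) →₀ F) :=
  Finsupp.linearCombination F fun i => e (i.1 + 1, i.2.1, i.2.2)

theorem opA_e (n : ℤ) (β γ : ℕ) : opA q (e (n, β, γ)) =
    q ^ (2 * β) • e (n - 1, β, γ) + q ^ (2 * β + 2) • e (n - 1, β + 1, γ + 1)
      - (q⁻¹ ^ 2 * (1 - q⁻¹ ^ (2 * β))) • e (n + 1, β, γ) := by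
  simp [opA, e]

theorem opB_e (n : ℤ) (β γ : ℕ) :
    opB q (e (n, β, γ)) = (q ^ n)⁻¹ ^ 2 • e (n, β + 1, γ) := by
  simp [opB, e]

theorem opC_e_zero (n : ℤ) (γ : ℕ) :
    opC q (e (n, 0, γ)) = (q ^ n) ^ 2 • e (n, 0, γ + 1) := by
  simp [opC, opCVal, e]

theorem opC_e_succ (n : ℤ) (β γ : ℕ) : opC q (e (n, β + 1, γ)) =
    (q ^ n) ^ 2 • (q ^ (2 * β + 2) • e (n, β + 1, γ + 1)
      + (q⁻¹ ^ 2 * (q ^ (2 * β + 2) - 1)) • e (n, β, γ)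
      - (1 - q⁻¹ ^ (2 * β + 2)) • e (n + 2, β, γ)) := by
  simp only [opC, opCVal, e, Finsupp.linearCombination_single, one_smul]

theorem opD_e (n : ℤ) (β γ : ℕ) : opD (F := F) (e (n, β, γ)) = e (n + 1, β, γ) := by
  simp [opD, e]

theorem end_ext {f g : Module.End F ((ℤ × ℕ × ℕ) →₀ F)}
    (h : ∀ n β γ, f (e (n, β, γ)) = g (e (n, β, γ))) : f = g :=
  Finsupp.lhom_ext' fun ⟨n, β, γ⟩ => LinearMap.ext_ring (h n β γ)

variable {q}

theorem opA_mul_opD : opA q * opD = opD * opA q := by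
  refine end_ext fun n β γ => ?_
  simp only [Module.End.mul_apply, opA_e, opD_e, map_add, map_sub, map_smul]
  rw [show n + 1 - 1 = n - 1 + 1 by ring]

theorem opD_mul_opB (hq : q ≠ 0) : opD * opB q = q ^ 2 • (opB q * opD) := by
  refine end_ext fun n β γ => ?_
  simp only [Module.End.mul_apply, LinearMap.smul_apply, opB_e, opD_e, map_smul]
  match_scalars
  rw [zpow_add₀ hq]; field_simp

theorem opC_mul_opD (hq : q ≠ 0) : opC q * opD = q ^ 2 • (opD * opC q) := by
  refine end_ext fun n β γ => ?_
  rcases β with _ | β <;>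
  simp only [Module.End.mul_apply, LinearMap.smul_apply, opC_e_zero, opC_e_succ, opD_e, map_smul,
    map_add, map_sub, show n + 2 + 1 = n + 1 + 2 by ring, zpow_add₀ hq, zpow_one] <;>
  module

theorem opA_mul_opB_sub (hq : q ≠ 0) :
    opA q * opB q - opB q * opA q = (-(1 - q⁻¹ ^ 2)) • (opB q * opD) := by
  refine end_ext fun n β γ => ?_
  simp only [Module.End.mul_apply, LinearMap.smul_apply, LinearMap.sub_apply, opA_e, opB_e, opD_e,
    map_smul, map_add, map_sub, zpow_add₀ hq, zpow_sub₀ hq, zpow_one, inv_pow]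
  match_scalars <;> field_simp <;> ring

theorem opC_mul_opB_sub (hq : q ≠ 0) :
    opC q * opB q - opB q * opC q = (1 - q⁻¹ ^ 2) • (opD * opA q - opD * opD) := by
  refine end_ext fun n β γ => ?_
  rcases β with _ | β <;>
  simp only [Module.End.mul_apply, LinearMap.smul_apply, LinearMap.sub_apply, opA_e, opB_e, opD_e,
    opC_e_zero, opC_e_succ, map_smul, map_add, map_sub, show n + 1 + 1 = n + 2 by ring,
    sub_add_cancel, zpow_add₀ hq, zpow_ofNat, inv_pow] <;>
  match_scalars <;> field_simp <;> ring

theorem opA_mul_opC_sub (hq : q ≠ 0) :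
    opA q * opC q - opC q * opA q = (1 - q⁻¹ ^ 2) • (opD * opC q) := by
  refine end_ext fun n β γ => ?_
  rcases β with _ | β <;>
  simp only [Module.End.mul_apply, LinearMap.smul_apply, LinearMap.sub_apply, opA_e, opD_e,
    opC_e_zero, opC_e_succ, map_smul, map_add, map_sub, show n - 1 + 2 = n + 1 by ring,
    show n + 2 - 1 = n + 1 by ring, show n + 2 + 1 = n + 1 + 2 by ring,
    zpow_add₀ hq, zpow_sub₀ hq, zpow_one, inv_pow] <;>
  match_scalars <;> field_simp <;> ring

theorem opA_mul_opD_sub (hq : q ≠ 0) : opA q * opD - q ^ 2 • (opB q * opC q) = 1 := by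
  refine end_ext fun n β γ => ?_
  rcases β with _ | β <;>
  simp only [Module.End.mul_apply, Module.End.one_apply, LinearMap.smul_apply, LinearMap.sub_apply,
    opA_e, opB_e, opD_e, opC_e_zero, opC_e_succ, map_smul, map_add, map_sub, add_sub_cancel_right,
    show n + 1 + 1 = n + 2 by ring, zpow_add₀ hq, zpow_ofNat, inv_pow] <;>
  match_scalars <;> field_simp <;> ring

theorem opD_pow_e (m : ℕ) (n : ℤ) (β γ : ℕ) :
    (opD (F := F) ^ m) (e (n, β, γ)) = e (n + m, β, γ) := by
  induction m with
  | zero => simp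
  | succ m ih =>
    rw [pow_succ', Module.End.mul_apply, ih, opD_e]
    push_cast
    rw [add_assoc]

theorem opB_pow_e (m β γ : ℕ) : (opB q ^ m) (e (0, β, γ)) = e (0, β + m, γ) := by
  induction m with
  | zero => simp
  | succ m ih => simp [pow_succ', Module.End.mul_apply, ih, opB_e, add_assoc]

theorem opC_pow_e (m : ℕ) : (opC q ^ m) (e (0, 0, 0)) = e (0, 0, m) := by
  induction m with
  | zero => simp
  | succ m ih => simp [pow_succ', Module.End.mul_apply, ih, opC_e_zero]

/-- The vectors supported on indices whose total degree in `b` and `c` is less than `k`. -/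
def degLT (F : Type*) [Field F] (k : ℕ) : Submodule F ((ℤ × ℕ × ℕ) →₀ F) :=
  Finsupp.supported F F {i | i.2.1 + i.2.2 < k}

theorem e_mem_degLT {k : ℕ} {n : ℤ} {β γ : ℕ} (h : β + γ < k) : e (n, β, γ) ∈ degLT F k :=
  Finsupp.single_mem_supported F 1 h

theorem opA_mem_degLT {k : ℕ} {v : (ℤ × ℕ × ℕ) →₀ F} (hv : v ∈ degLT F k) :
    opA q v ∈ degLT F (k + 2) := by
  have hle : degLT F k ≤ (degLT F (k + 2)).comap (opA q) := by
    rw [degLT, Finsupp.supported_eq_span_single, Submodule.span_le]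
    rintro _ ⟨⟨n, β, γ⟩, h, rfl⟩
    replace h : β + γ < k := h
    change opA q (e (n, β, γ)) ∈ degLT F (k + 2)
    rw [opA_e]
    refine sub_mem (add_mem ?_ ?_) ?_ <;> refine Submodule.smul_mem _ _ (e_mem_degLT ?_) <;> omega
  exact hle hv

theorem opA_pow_e (hq : q ≠ 0) (m β γ : ℕ) : ∃ u : F, u ≠ 0 ∧
    (opA q ^ m) (e (0, β, γ)) - u • e (-m, β + m, γ + m) ∈ degLT F (β + γ + 2 * m) := by
  induction m with
  | zero => exact ⟨1, one_ne_zero, by simp⟩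
  | succ m ih =>
    obtain ⟨u, hu, h⟩ := ih
    refine ⟨u * q ^ (2 * (β + m) + 2), mul_ne_zero hu (pow_ne_zero _ hq), ?_⟩
    have h₂ := opA_mem_degLT (q := q) h
    rw [map_sub, map_smul, opA_e, ← Module.End.mul_apply, ← pow_succ'] at h₂
    have hx : e (-(m : ℤ) - 1, β + m, γ + m) ∈ degLT F (β + γ + 2 * m + 2) :=
      e_mem_degLT (by omega)
    have hy : e (-(m : ℤ) + 1, β + m, γ + m) ∈ degLT F (β + γ + 2 * m + 2) :=
      e_mem_degLT (by omega)
    have h₃ := add_mem h₂ (sub_mem (Submodule.smul_mem _ (u * q ^ (2 * (β + m))) hx)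
      (Submodule.smul_mem _ (u * (q⁻¹ ^ 2 * (1 - q⁻¹ ^ (2 * (β + m))))) hy))
    rw [mul_add, mul_one, ← add_assoc]
    convert h₃ using 1
    rw [show (-((m + 1 : ℕ) : ℤ)) = -(m : ℤ) - 1 by push_cast; ring, ← add_assoc, ← add_assoc]
    module

end Representation

theorem qv_ne_zero : qv ≠ 0 := RatFunc.X_ne_zero

/-- The representation of `𝒜` by the operators `opA`, `opB`, `opC`, `opD`. -/
def rep : Aalg →ₐ[Kq] Module.End Kq ((ℤ × ℕ × ℕ) →₀ Kq) :=
  RingQuot.liftAlgHom Kq ⟨FreeAlgebra.lift Kq fun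
    | AGen.a => opA qv
    | AGen.b => opB qv
    | AGen.c => opC qv
    | AGen.d => opD, by
      intro x y h
      cases h <;>
        simp only [map_mul, map_sub, map_smul, map_one, FreeAlgebra.lift_ι_apply]
      exacts [opA_mul_opD, opD_mul_opB qv_ne_zero, opC_mul_opD qv_ne_zero,
        opA_mul_opB_sub qv_ne_zero, opC_mul_opB_sub qv_ne_zero, opA_mul_opC_sub qv_ne_zero,
        opA_mul_opD_sub qv_ne_zero]⟩

theorem rep_aA : rep aA = opA qv := by simp [rep, aA]
theorem rep_bA : rep bA = opB qv := by simp [rep, bA]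
theorem rep_cA : rep cA = opC qv := by simp [rep, cA]
theorem rep_dA : rep dA = opD := by simp [rep, dA]

/-- The image of `1` under the action of an element of `𝒜`. -/
def orbitMap : Aalg →ₗ[Kq] ((ℤ × ℕ × ℕ) →₀ Kq) :=
  (LinearMap.applyₗ (e (0, 0, 0))).comp rep.toLinearMap

theorem orbitMap_apply (x : Aalg) : orbitMap x = rep x (e (0, 0, 0)) := rfl

/-- The index of the leading term of the image of a monomial under `orbitMap`. -/
def lead : (ℕ × ℕ × ℕ) ⊕ (ℕ × ℕ × ℕ) → ℤ × ℕ × ℕ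
  | Sum.inl (α, β, γ) => (-((α + 1 : ℕ) : ℤ), β + (α + 1), γ + (α + 1))
  | Sum.inr (δ, β, γ) => (δ, β, γ)

theorem lead_injective : Function.Injective lead := by
  rintro (⟨α, β, γ⟩ | ⟨δ, β, γ⟩) (⟨α', β', γ'⟩ | ⟨δ', β', γ'⟩) h <;>
    simp only [lead, Prod.mk.injEq, Sum.inl.injEq, Sum.inr.injEq, reduceCtorEq] at h ⊢ <;> omega

theorem orbitMap_monA (i : (ℕ × ℕ × ℕ) ⊕ (ℕ × ℕ × ℕ)) : ∃ u : Kq, u ≠ 0 ∧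
    orbitMap (monA i) - u • e (lead i) ∈ degLT Kq ((lead i).2.1 + (lead i).2.2) := by
  rcases i with ⟨α, β, γ⟩ | ⟨δ, β, γ⟩
  · obtain ⟨u, hu, h⟩ := opA_pow_e qv_ne_zero (α + 1) β γ
    refine ⟨u, hu, ?_⟩
    simpa [orbitMap_apply, monA, lead, rep_aA, rep_bA, rep_cA, opC_pow_e, opB_pow_e,
      show β + (α + 1) + (γ + (α + 1)) = β + γ + 2 * (α + 1) by ring] using h
  · refine ⟨1, one_ne_zero, ?_⟩
    simp [orbitMap_apply, monA, lead, rep_dA, rep_bA, rep_cA, opC_pow_e, opB_pow_e, opD_pow_e]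

/-- A family of finitely supported functions with distinct leading indices is linearly
independent. -/
theorem linearIndependent_of_lead {F ι κ : Type*} [Field F] (v : ι → κ →₀ F) (p : ι → κ)
    (hp : Function.Injective p) (deg : κ → ℕ) (hne : ∀ i, v i (p i) ≠ 0)
    (hlt : ∀ i x, v i x ≠ 0 → x = p i ∨ deg x < deg (p i)) : LinearIndependent F v := by
  rw [linearIndependent_iff]
  intro l hl
  by_contra hl0
  obtain ⟨i, hi, hmax⟩ := l.support.exists_max_image (fun i => deg (p i))
    (Finsupp.support_nonempty_iff.mpr hl0)
  have h := DFunLike.congr_fun hl (p i)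
  rw [Finsupp.linearCombination_apply, Finsupp.sum, Finsupp.finsetSum_apply,
    Finset.sum_eq_single_of_mem i hi] at h
  · exact mul_ne_zero (Finsupp.mem_support_iff.mp hi) (hne i) h
  · intro j hj hji
    by_contra hj0
    rcases hlt j (p i) (right_ne_zero_of_mul hj0) with h' | h'
    · exact hji (hp h').symm
    · exact (hmax j hj).not_gt h'

theorem linearIndependent_monA : LinearIndependent Kq monA := by
  refine LinearIndependent.of_comp orbitMap ?_
  have hval (i : (ℕ × ℕ × ℕ) ⊕ (ℕ × ℕ × ℕ)) : ∃ u : Kq, u ≠ 0 ∧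
      ∀ x, (lead i).2.1 + (lead i).2.2 ≤ x.2.1 + x.2.2 →
        orbitMap (monA i) x = u * e (lead i) x := by
    obtain ⟨u, hu, h⟩ := orbitMap_monA i
    refine ⟨u, hu, fun x hx => ?_⟩
    have := (Finsupp.mem_supported' _ _).mp h x (by simpa using hx)
    simpa [sub_eq_zero] using this
  refine linearIndependent_of_lead _ lead lead_injective (fun x => x.2.1 + x.2.2) ?_ ?_
  · intro i
    obtain ⟨u, hu, h⟩ := hval i
    simpa [h _ le_rfl, e] using hu
  · intro i x hx
    obtain ⟨u, -, h⟩ := hval i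
    by_contra! hc
    exact hx (by simp [h x hc.2, e, hc.1.symm])

/-! ### Spanning -/

theorem aA_mul_dA : aA * dA = dA * aA := by
  simpa [aA, dA] using RingQuot.mkAlgHom_rel Kq ARel.ad_comm

theorem dA_mul_bA : dA * bA = qv ^ 2 • (bA * dA) := by
  simpa [bA, dA] using RingQuot.mkAlgHom_rel Kq ARel.db

theorem cA_mul_dA : cA * dA = qv ^ 2 • (dA * cA) := by
  simpa [cA, dA] using RingQuot.mkAlgHom_rel Kq ARel.cd

theorem aA_mul_bA_sub : aA * bA - bA * aA = (-(1 - qv⁻¹ ^ 2)) • (bA * dA) := by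
  simpa only [map_mul, map_sub, map_smul] using! RingQuot.mkAlgHom_rel Kq ARel.ab

theorem cA_mul_bA_sub : cA * bA - bA * cA = (1 - qv⁻¹ ^ 2) • (dA * aA - dA * dA) := by
  simpa only [map_mul, map_sub, map_smul] using! RingQuot.mkAlgHom_rel Kq ARel.cb

theorem aA_mul_cA_sub : aA * cA - cA * aA = (1 - qv⁻¹ ^ 2) • (dA * cA) := by
  simpa only [map_mul, map_sub, map_smul] using! RingQuot.mkAlgHom_rel Kq ARel.ac

theorem aA_mul_dA_sub : aA * dA - qv ^ 2 • (bA * cA) = 1 := by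
  simpa only [map_mul, map_sub, map_smul, map_one] using! RingQuot.mkAlgHom_rel Kq ARel.det

theorem bA_mul_dA : bA * dA = qv⁻¹ ^ 2 • (dA * bA) := by
  rw [dA_mul_bA, smul_smul, ← mul_pow, inv_mul_cancel₀ qv_ne_zero, one_pow, one_smul]

theorem eq_sub_smul_of_sub_eq {R M : Type*} [Ring R] [AddCommGroup M] [Module R M] {x y z : M}
    {t : R} (h : x - y = (-t) • z) : x = y - t • z := by
  rw [sub_eq_iff_eq_add'.mp h, neg_smul, sub_eq_add_neg]

theorem aA_mul_bA : aA * bA = bA * aA - (1 - qv⁻¹ ^ 2) • (bA * dA) :=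
  eq_sub_smul_of_sub_eq aA_mul_bA_sub

theorem bA_mul_aA : bA * aA = aA * bA + ((1 - qv⁻¹ ^ 2) * qv⁻¹ ^ 2) • (dA * bA) := by
  rw [mul_smul, ← bA_mul_dA, aA_mul_bA, sub_add_cancel]

theorem cA_mul_aA : cA * aA = aA * cA - (1 - qv⁻¹ ^ 2) • (dA * cA) := by
  rw [← aA_mul_cA_sub, sub_sub_cancel]

theorem cA_mul_bA : cA * bA = bA * cA + (1 - qv⁻¹ ^ 2) • (dA * aA - dA * dA) := by
  rw [← cA_mul_bA_sub, add_sub_cancel]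

/-- The span of the monomials `d ^ n * a ^ m * b ^ β * c ^ γ`. -/
def fullSpan : Submodule Kq Aalg :=
  Submodule.span Kq (Set.range fun i : ℕ × ℕ × ℕ × ℕ =>
    dA ^ i.1 * (aA ^ i.2.1 * (bA ^ i.2.2.1 * cA ^ i.2.2.2)))

theorem mem_fullSpan (n m β γ : ℕ) : dA ^ n * (aA ^ m * (bA ^ β * cA ^ γ)) ∈ fullSpan :=
  Submodule.subset_span ⟨(n, m, β, γ), rfl⟩

theorem mul_mem_fullSpan {x y : Aalg} (hy : y ∈ fullSpan)
    (h : ∀ n m β γ, x * (dA ^ n * (aA ^ m * (bA ^ β * cA ^ γ))) ∈ fullSpan) :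
    x * y ∈ fullSpan := by
  have hle : fullSpan ≤ fullSpan.comap (LinearMap.mulLeft Kq x) :=
    Submodule.span_le.mpr (Set.range_subset_iff.mpr fun i => h i.1 i.2.1 i.2.2.1 i.2.2.2)
  exact hle hy

theorem dA_mul_mem {y : Aalg} (hy : y ∈ fullSpan) : dA * y ∈ fullSpan :=
  mul_mem_fullSpan hy fun n m β γ => by
    rw [← mul_assoc, ← pow_succ']
    exact mem_fullSpan _ _ _ _

theorem aA_mul_mem {y : Aalg} (hy : y ∈ fullSpan) : aA * y ∈ fullSpan :=
  mul_mem_fullSpan hy fun n m β γ => by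
    have hc : Commute aA dA := aA_mul_dA
    rw [← mul_assoc, (hc.pow_right n).eq, mul_assoc, ← mul_assoc aA, ← pow_succ']
    exact mem_fullSpan _ _ _ _

theorem bA_mul_mem {y : Aalg} (hy : y ∈ fullSpan) : bA * y ∈ fullSpan :=
  mul_mem_fullSpan hy fun n m β γ => by
    induction n with
    | zero =>
      rw [pow_zero, one_mul]
      induction m with
      | zero => simpa [pow_succ', mul_assoc] using mem_fullSpan 0 0 (β + 1) γ
      | succ m ih =>
        rw [pow_succ', mul_assoc, ← mul_assoc, bA_mul_aA, add_mul, smul_mul_assoc, mul_assoc,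
          mul_assoc]
        exact add_mem (aA_mul_mem ih) (Submodule.smul_mem _ _ (dA_mul_mem ih))
    | succ n ih =>
      rw [pow_succ', mul_assoc, ← mul_assoc, bA_mul_dA, smul_mul_assoc, mul_assoc]
      exact Submodule.smul_mem _ _ (dA_mul_mem ih)

theorem cA_mul_mem {y : Aalg} (hy : y ∈ fullSpan) : cA * y ∈ fullSpan :=
  mul_mem_fullSpan hy fun n m β γ => by
    induction n with
    | zero =>
      rw [pow_zero, one_mul]
      induction m with
      | zero =>
        rw [pow_zero, one_mul]
        induction β with
        | zero => simpa [pow_succ'] using mem_fullSpan 0 0 0 (γ + 1)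
        | succ β ih =>
          have hy : bA ^ β * cA ^ γ ∈ fullSpan := by simpa using mem_fullSpan 0 0 β γ
          rw [pow_succ', mul_assoc, ← mul_assoc, cA_mul_bA, add_mul, smul_mul_assoc, sub_mul,
            mul_assoc, mul_assoc, mul_assoc]
          exact add_mem (bA_mul_mem ih) (Submodule.smul_mem _ _
            (sub_mem (dA_mul_mem (aA_mul_mem hy)) (dA_mul_mem (dA_mul_mem hy))))
      | succ m ih =>
        rw [pow_succ', mul_assoc, ← mul_assoc, cA_mul_aA, sub_mul, smul_mul_assoc, mul_assoc,
          mul_assoc]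
        exact sub_mem (aA_mul_mem ih) (Submodule.smul_mem _ _ (dA_mul_mem ih))
    | succ n ih =>
      rw [pow_succ', mul_assoc, ← mul_assoc, cA_mul_dA, smul_mul_assoc, mul_assoc]
      exact Submodule.smul_mem _ _ (dA_mul_mem ih)

theorem fullSpan_eq_top : fullSpan = ⊤ := by
  have key (x : FreeAlgebra Kq AGen) :
      ∀ y ∈ fullSpan, RingQuot.mkAlgHom Kq ARel x * y ∈ fullSpan := by
    induction x using FreeAlgebra.induction with
    | grade0 r =>
      intro y hy
      rw [AlgHom.commutes, ← Algebra.smul_def]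
      exact Submodule.smul_mem _ _ hy
    | grade1 g =>
      intro y hy
      cases g
      exacts [aA_mul_mem hy, bA_mul_mem hy, cA_mul_mem hy, dA_mul_mem hy]
    | mul x₁ x₂ h₁ h₂ =>
      intro y hy
      rw [map_mul, mul_assoc]
      exact h₁ _ (h₂ _ hy)
    | add x₁ x₂ h₁ h₂ =>
      intro y hy
      rw [map_add, add_mul]
      exact add_mem (h₁ _ hy) (h₂ _ hy)
  refine eq_top_iff.mpr fun x _ => ?_
  obtain ⟨x, rfl⟩ := RingQuot.mkAlgHom_surjective Kq ARel x
  simpa using key x 1 (by simpa using mem_fullSpan 0 0 0 0)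

theorem dA_mul_aA_mul_bA : dA * aA * bA =
    qv ^ 2 • (bA * (dA * aA)) - (qv ^ 2 - 1) • (bA * (dA * dA)) := by
  rw [mul_assoc, aA_mul_bA, mul_sub, mul_smul_comm, ← mul_assoc, ← mul_assoc, dA_mul_bA, smul_mul_assoc,
    smul_mul_assoc, smul_smul, mul_assoc, mul_assoc, sub_mul, one_mul, ← mul_pow,
    inv_mul_cancel₀ qv_ne_zero, one_pow]

theorem bA_mul_dA_sq : bA * (dA * dA) = qv⁻¹ ^ 4 • (dA * dA * bA) := by
  rw [← mul_assoc, bA_mul_dA, smul_mul_assoc, mul_assoc, bA_mul_dA, mul_smul_comm, smul_smul,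
    ← pow_add, mul_assoc]

theorem smul_add_sub_smul {R M : Type*} [CommRing R] [AddCommGroup M] [Module R M]
    (p r k x y z : R) (u v w : M) :
    p • (x • u + y • v + z • (k • w)) - r • (k • w) =
      (p * x) • u + (p * y) • v + ((p * z - r) * k) • w := by
  module

theorem dA_mul_aA_mul_bA_pow (β : ℕ) : ∃ x y z : Kq,
    dA * aA * bA ^ β = x • bA ^ β + y • (bA ^ (β + 1) * cA) + z • (dA * dA * bA ^ β) := by
  induction β with
  | zero =>
    refine ⟨1, qv ^ 2, 0, ?_⟩
    have := aA_mul_dA_sub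
    rw [sub_eq_iff_eq_add, aA_mul_dA] at this
    simp [this]
  | succ β ih =>
    obtain ⟨x, y, z, h⟩ := ih
    refine ⟨qv ^ 2 * x, qv ^ 2 * y, (qv ^ 2 * z - (qv ^ 2 - 1)) * qv⁻¹ ^ 4, ?_⟩
    have h₂ : bA * (dA * dA * bA ^ β) = qv⁻¹ ^ 4 • (dA * dA * bA ^ (β + 1)) := by
      rw [← mul_assoc, bA_mul_dA_sq, smul_mul_assoc, mul_assoc _ bA, ← pow_succ']
    calc dA * aA * bA ^ (β + 1)
        = qv ^ 2 • (bA * (dA * aA * bA ^ β)) - (qv ^ 2 - 1) • (bA * (dA * dA * bA ^ β)) := by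
          rw [pow_succ', ← mul_assoc, dA_mul_aA_mul_bA, sub_mul, smul_mul_assoc, smul_mul_assoc,
            mul_assoc bA, mul_assoc bA]
      _ = _ := by
          rw [h, mul_add, mul_add, mul_smul_comm, mul_smul_comm, mul_smul_comm, h₂, ← mul_assoc bA,
            ← pow_succ', ← pow_succ']
          exact smul_add_sub_smul (qv ^ 2) (qv ^ 2 - 1) (qv⁻¹ ^ 4) x y z _ _ _

theorem mem_span_monA (m n β γ : ℕ) :
    dA ^ n * (aA ^ m * (bA ^ β * cA ^ γ)) ∈ Submodule.span Kq (Set.range monA) := by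
  induction m generalizing n β γ with
  | zero => exact Submodule.subset_span ⟨Sum.inr (n, β, γ), by simp [monA, mul_assoc]⟩
  | succ m ih =>
    cases n with
    | zero => exact Submodule.subset_span ⟨Sum.inl (m, β, γ), by simp [monA, mul_assoc]⟩
    | succ n =>
      obtain ⟨x, y, z, h⟩ := dA_mul_aA_mul_bA_pow β
      have hc : Commute dA aA := aA_mul_dA.symm
      have hda : dA ^ (n + 1) * (aA ^ (m + 1) * (bA ^ β * cA ^ γ)) =
          dA ^ n * (aA ^ m * (dA * aA * bA ^ β * cA ^ γ)) := by
        rw [pow_succ, pow_succ, mul_assoc, ← mul_assoc dA, ← mul_assoc dA,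
          (hc.pow_right m).eq]
        simp only [mul_assoc]
      have hdd : dA ^ n * (aA ^ m * (dA * dA * bA ^ β * cA ^ γ)) =
          dA ^ (n + 2) * (aA ^ m * (bA ^ β * cA ^ γ)) := by
        rw [pow_add, sq, mul_assoc (dA * dA), ← mul_assoc (aA ^ m),
          ← ((hc.mul_left hc).pow_right m).eq]
        simp only [mul_assoc]
      rw [hda, h]
      simp only [add_mul, mul_add, smul_mul_assoc, mul_smul_comm, hdd, mul_assoc _ cA, ← pow_succ']
      exact add_mem (add_mem (Submodule.smul_mem _ _ (ih _ _ _)) (Submodule.smul_mem _ _ (ih _ _ _)))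
        (Submodule.smul_mem _ _ (ih _ _ _))

theorem span_monA : Submodule.span Kq (Set.range monA) = ⊤ := by
  rw [eq_top_iff, ← fullSpan_eq_top, fullSpan, Submodule.span_le, Set.range_subset_iff]
  exact fun i => mem_span_monA i.2.1 i.1 i.2.2.1 i.2.2.2

end LoopAlg

/-- The monomials `a^α b^β c^γ` with `α ≥ 1`, together with the monomials `d^δ b^β c^γ`,
form a basis of `𝒜 = ℒ_{0,1}(sl(2))` as a `ℂ(q)`-vector space. -/
theorem statement0 :
    LinearIndependent Kq monA ∧ Submodule.span Kq (Set.range monA) = ⊤ :=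
  ⟨LoopAlg.linearIndependent_monA, LoopAlg.span_monA⟩
end
end

section
/- There is a unique ℂ(q)-algebra homomorphism Φ_1 : 𝒜 → U_q with Φ_1(a) = K + q^{-1}(q - q^{-1})^2 F E, Φ_1(b) = q^{-1}(q - q^{-1}) F, Φ_1(c) = (q - q^{-1}) K^{-1} E, Φ_1(d) = K^{-1}, and this homomorphism Φ_1 is injective. -/
noncomputable section

/-- Generators `E`, `F`, `K`, `K⁻¹` of the quantum group `U_q(sl(2))`. -/
inductive UGen : Type
  | E | F | K | Kinv

/-- The defining relations of `U_q(sl(2))`. -/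
inductive URel : FreeAlgebra Kq UGen → FreeAlgebra Kq UGen → Prop
  | KKinv : URel (FreeAlgebra.ι Kq UGen.K * FreeAlgebra.ι Kq UGen.Kinv) 1
  | KinvK : URel (FreeAlgebra.ι Kq UGen.Kinv * FreeAlgebra.ι Kq UGen.K) 1
  | KE : URel (FreeAlgebra.ι Kq UGen.K * FreeAlgebra.ι Kq UGen.E * FreeAlgebra.ι Kq UGen.Kinv)
      ((qv ^ 2) • FreeAlgebra.ι Kq UGen.E)
  | KF : URel (FreeAlgebra.ι Kq UGen.K * FreeAlgebra.ι Kq UGen.F * FreeAlgebra.ι Kq UGen.Kinv)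
      ((qv⁻¹ ^ 2) • FreeAlgebra.ι Kq UGen.F)
  | EF : URel (FreeAlgebra.ι Kq UGen.E * FreeAlgebra.ι Kq UGen.F
        - FreeAlgebra.ι Kq UGen.F * FreeAlgebra.ι Kq UGen.E)
      (((qv - qv⁻¹)⁻¹) • (FreeAlgebra.ι Kq UGen.K - FreeAlgebra.ι Kq UGen.Kinv))

/-- The quantum group `U_q = U_q(sl(2))`, presented by generators and relations. -/
abbrev Uq : Type := RingQuot URel

noncomputable def Eel : Uq := RingQuot.mkAlgHom Kq URel (FreeAlgebra.ι Kq UGen.E)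
noncomputable def Fel : Uq := RingQuot.mkAlgHom Kq URel (FreeAlgebra.ι Kq UGen.F)
noncomputable def Kel : Uq := RingQuot.mkAlgHom Kq URel (FreeAlgebra.ι Kq UGen.K)
noncomputable def Kinvel : Uq := RingQuot.mkAlgHom Kq URel (FreeAlgebra.ι Kq UGen.Kinv)

section GeneralizedWeyl

variable {k A : Type*} [Field k] [Ring A] [Algebra k A]

/-- The family of powers `…, c ^ 2, c, 1, b, b ^ 2, …` indexed by the integers. -/
def signedPow (b c : A) : ℤ → A
  | Int.ofNat n => b ^ n
  | Int.negSucc n => c ^ (n + 1)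

/-- The monomials `bⁿ wⁱ dʲ` and `cⁿ wⁱ dʲ`. -/
def gwaMonomial (b c w d : A) (x : Σ _ : ℤ, ℕ × ℕ) : A :=
  signedPow b c x.1 * (w ^ x.2.1 * d ^ x.2.2)

lemma signedPow_neg_natCast (b c : A) (m : ℕ) : signedPow b c (-(m : ℤ)) = c ^ m := by
  cases m with
  | zero => simp [signedPow]
  | succ m => exact congrArg (signedPow b c) (Int.negSucc_eq m).symm |>.trans rfl

lemma exists_mul_pow_eq_smul {b d : A} {r : k} (h : d * b = r • (b * d)) (n : ℕ) :
    ∃ t : k, d * b ^ n = t • (b ^ n * d) := by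
  induction n with
  | zero => exact ⟨1, by simp⟩
  | succ n ih =>
    obtain ⟨t, ht⟩ := ih
    refine ⟨t * r, ?_⟩
    rw [pow_succ, ← mul_assoc, ht, smul_mul_assoc, mul_assoc, h, mul_smul_comm, smul_smul,
      mul_assoc]

lemma exists_mul_signedPow_eq_smul {b c d : A} {r s : k} (hb : d * b = r • (b * d))
    (hc : d * c = s • (c * d)) (n : ℤ) :
    ∃ t : k, d * signedPow b c n = t • (signedPow b c n * d) := by
  cases n with
  | ofNat n => exact exists_mul_pow_eq_smul hb n
  | negSucc n => exact exists_mul_pow_eq_smul hc (n + 1)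

lemma mem_span_of_forall_range {ι : Type*} {m : ι → A} {g : A}
    (h : ∀ i, g * m i ∈ Submodule.span k (Set.range m)) {x : A}
    (hx : x ∈ Submodule.span k (Set.range m)) : g * x ∈ Submodule.span k (Set.range m) := by
  induction hx using Submodule.span_induction with
  | mem x hx => obtain ⟨i, rfl⟩ := hx; exact h i
  | zero => simp
  | add x y _ _ hx hy => rw [mul_add]; exact add_mem hx hy
  | smul t x _ hx => rw [mul_smul_comm]; exact Submodule.smul_mem _ _ hx

lemma span_range_gwaMonomial_eq_top {b c w d : A} {r s α₁ α₂ α₃ β₁ β₂ β₃ : k}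
    (hb : d * b = r • (b * d)) (hc : d * c = s • (c * d))
    (hwb : w * b = b * w) (hwc : w * c = c * w) (hwd : w * d = d * w)
    (hbc : b * c = α₁ • (w * d) + α₂ • (d * d) + α₃ • 1)
    (hcb : c * b = β₁ • (w * d) + β₂ • (d * d) + β₃ • 1)
    (htop : Algebra.adjoin k {w, b, c, d} = ⊤) :
    Submodule.span k (Set.range (gwaMonomial b c w d)) = ⊤ := by
  set N := Submodule.span k (Set.range (gwaMonomial b c w d)) with hN
  have mon (n : ℤ) (i j : ℕ) : signedPow b c n * (w ^ i * d ^ j) ∈ N :=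
    Submodule.subset_span ⟨⟨n, i, j⟩, rfl⟩
  have hd {x : A} : x ∈ N → d * x ∈ N := by
    refine mem_span_of_forall_range fun ⟨n, i, j⟩ ↦ ?_
    obtain ⟨t, ht⟩ := exists_mul_signedPow_eq_smul hb hc n
    have hdw : d * w ^ i = w ^ i * d := ((show Commute w d from hwd).pow_left i).symm
    rw [gwaMonomial, ← mul_assoc, ht, smul_mul_assoc, mul_assoc, ← mul_assoc d, hdw, mul_assoc,
      ← pow_succ']
    exact Submodule.smul_mem _ _ (mon n i (j + 1))
  have hw {x : A} : x ∈ N → w * x ∈ N := by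
    refine mem_span_of_forall_range fun ⟨n, i, j⟩ ↦ ?_
    have ht : w * signedPow b c n = signedPow b c n * w := by
      cases n with
      | ofNat n => exact (show Commute w b from hwb).pow_right n
      | negSucc n => exact (show Commute w c from hwc).pow_right (n + 1)
    rw [gwaMonomial, ← mul_assoc, ht, mul_assoc, ← mul_assoc w, ← pow_succ']
    exact mon n (i + 1) j
  have comb {t₁ t₂ t₃ : k} {x : A} (hx : x ∈ N) :
      (t₁ • (w * d) + t₂ • (d * d) + t₃ • 1) * x ∈ N := by
    simp only [add_mul, smul_mul_assoc, one_mul, mul_assoc]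
    exact add_mem (add_mem (Submodule.smul_mem _ _ (hw (hd hx)))
      (Submodule.smul_mem _ _ (hd (hd hx)))) (Submodule.smul_mem _ _ hx)
  have hb' {x : A} : x ∈ N → b * x ∈ N := by
    refine mem_span_of_forall_range fun ⟨n, i, j⟩ ↦ ?_
    rw [gwaMonomial, ← mul_assoc]
    cases n with
    | ofNat n =>
      have := mon (Int.ofNat (n + 1)) i j
      rwa [signedPow, pow_succ'] at this
    | negSucc n =>
      have := comb (t₁ := α₁) (t₂ := α₂) (t₃ := α₃) (mon (-(n : ℤ)) i j)
      rwa [signedPow_neg_natCast, ← hbc, ← mul_assoc, mul_assoc b, ← pow_succ'] at this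
  have hc' {x : A} : x ∈ N → c * x ∈ N := by
    refine mem_span_of_forall_range fun ⟨n, i, j⟩ ↦ ?_
    rw [gwaMonomial, ← mul_assoc]
    obtain ⟨m, rfl | rfl⟩ := n.eq_nat_or_neg
    · cases m with
      | zero =>
        have := mon (-((1 : ℕ) : ℤ)) i j
        rw [signedPow_neg_natCast] at this
        simpa [signedPow] using this
      | succ m =>
        have := comb (t₁ := β₁) (t₂ := β₂) (t₃ := β₃) (mon (Int.ofNat m) i j)
        rwa [← hcb, signedPow, ← mul_assoc, mul_assoc c, ← pow_succ'] at this
    · have := mon (-((m + 1 : ℕ) : ℤ)) i j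
      rwa [signedPow_neg_natCast, pow_succ', ← signedPow_neg_natCast b] at this
  have key (x : A) (hx : x ∈ Algebra.adjoin k {w, b, c, d}) : ∀ y ∈ N, x * y ∈ N := by
    induction hx using Algebra.adjoin_induction with
    | mem x hx =>
      rcases hx with rfl | rfl | rfl | rfl
      exacts [fun _ ↦ hw, fun _ ↦ hb', fun _ ↦ hc', fun _ ↦ hd]
    | algebraMap t =>
      intro y hy
      rw [← Algebra.smul_def]
      exact Submodule.smul_mem _ _ hy
    | add x y _ _ hx hy =>
      intro z hz
      rw [add_mul]
      exact add_mem (hx z hz) (hy z hz)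
    | mul x y _ _ hx hy =>
      intro z hz
      rw [mul_assoc]
      exact hx _ (hy z hz)
  refine eq_top_iff.2 fun x _ ↦ ?_
  have h1 : (1 : A) ∈ N := by simpa [signedPow] using mon 0 0 0
  simpa using key x (htop ▸ Algebra.mem_top) 1 h1

end GeneralizedWeyl

section Relations

variable {k B : Type*} [Field k] [Ring B] [Algebra k B] {q : k}

lemma smul_add_smul_inv_mul_comm (hq : q ≠ 0) {a b d : B} (hdb : d * b = q ^ 2 • (b * d))
    (hab : a * b - b * a = (-(1 - q⁻¹ ^ 2)) • (b * d)) :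
    (q • a + q⁻¹ • d) * b = b * (q • a + q⁻¹ • d) := by
  simp only [add_mul, mul_add, smul_mul_assoc, mul_smul_comm]
  rw [hdb, sub_eq_iff_eq_add.1 hab]
  match_scalars <;> field_simp; ring

lemma smul_add_smul_inv_mul_comm' (hq : q ≠ 0) {a c d : B} (hcd : c * d = q ^ 2 • (d * c))
    (hac : a * c - c * a = (1 - q⁻¹ ^ 2) • (d * c)) :
    (q • a + q⁻¹ • d) * c = c * (q • a + q⁻¹ • d) := by
  simp only [add_mul, mul_add, smul_mul_assoc, mul_smul_comm]
  rw [hcd, sub_eq_iff_eq_add.1 hac]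
  match_scalars <;> field_simp; ring

lemma eq_smul_sub_smul_of_eq (hq : q ≠ 0) {a d w : B} (hw : w = q • a + q⁻¹ • d) :
    a = q⁻¹ • w - q⁻¹ ^ 2 • d := by
  rw [hw]
  match_scalars <;> field_simp; ring

lemma mul_eq_of_det (hq : q ≠ 0) {a b c d w : B} (hw : w = q • a + q⁻¹ • d)
    (hdet : a * d - q ^ 2 • (b * c) = 1) :
    b * c = q⁻¹ ^ 3 • (w * d) + (-q⁻¹ ^ 4) • (d * d) + (-q⁻¹ ^ 2) • 1 := by
  rw [← hdet, hw]
  simp only [add_mul, smul_mul_assoc]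
  match_scalars <;> field_simp <;> ring

lemma mul_eq_of_mul_sub (hq : q ≠ 0) {a b c d w : B} (hw : w = q • a + q⁻¹ • d)
    (had : a * d = d * a) (hcb : c * b - b * c = (1 - q⁻¹ ^ 2) • (d * a - d * d))
    (hdet : a * d - q ^ 2 • (b * c) = 1) :
    c * b = q⁻¹ • (w * d) + (-1 : k) • (d * d) + (-q⁻¹ ^ 2) • 1 := by
  rw [sub_eq_iff_eq_add.1 hcb, mul_eq_of_det hq hw hdet, ← had, hw]
  simp only [add_mul, smul_mul_assoc]
  match_scalars <;> field_simp <;> ring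

variable {E F K K' : B}

lemma conj_eq_iff_mul_eq (hKK' : K * K' = 1) (hK'K : K' * K = 1) {X Y : B} :
    K * X * K' = Y ↔ K * X = Y * K := by
  constructor
  · rintro rfl; rw [mul_assoc _ K' K, hK'K, mul_one]
  · intro h; rw [h, mul_assoc, hKK', mul_one]

lemma inv_mul_eq_of_conj_eq (hK'K : K' * K = 1) {X : B} {r : k} (hr : r ≠ 0)
    (h : K * X * K' = r • X) : K' * X = r⁻¹ • (X * K') := by
  have : X * K' = r • (K' * X) := by
    rw [← mul_smul_comm, ← h, ← mul_assoc, ← mul_assoc, hK'K, one_mul]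
  rw [this, inv_smul_smul₀ hr]

lemma exists_quantum_relations (hq : q ≠ 0) (hγ : q - q⁻¹ ≠ 0) (hKK' : K * K' = 1)
    (hK'K : K' * K = 1) (hKE : K * E * K' = q ^ 2 • E) (hKF : K * F * K' = q⁻¹ ^ 2 • F)
    (hEF : E * F - F * E = (q - q⁻¹)⁻¹ • (K - K')) {a b c d : B}
    (ha : a = K + (q⁻¹ * (q - q⁻¹) ^ 2) • (F * E)) (hb : b = (q⁻¹ * (q - q⁻¹)) • F)
    (hc : c = (q - q⁻¹) • (K' * E)) (hd : d = K') :
    a * d = d * a ∧ d * b = q ^ 2 • (b * d) ∧ c * d = q ^ 2 • (d * c) ∧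
      a * b - b * a = (-(1 - q⁻¹ ^ 2)) • (b * d) ∧
      c * b - b * c = (1 - q⁻¹ ^ 2) • (d * a - d * d) ∧
      a * c - c * a = (1 - q⁻¹ ^ 2) • (d * c) ∧
      a * d - q ^ 2 • (b * c) = 1 := by
  have h1 : K' * F = q ^ 2 • (F * K') := by
    simpa using inv_mul_eq_of_conj_eq hK'K (pow_ne_zero 2 (inv_ne_zero hq)) hKF
  have h2 : E * K' = q ^ 2 • (K' * E) := by
    rw [inv_mul_eq_of_conj_eq hK'K (pow_ne_zero 2 hq) hKE, smul_inv_smul₀ (pow_ne_zero 2 hq)]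
  have h3 : K * F = q⁻¹ ^ 2 • (F * K) := by
    rw [(conj_eq_iff_mul_eq hKK' hK'K).1 hKF, smul_mul_assoc]
  have h4 : E * F = F * E + (q - q⁻¹)⁻¹ • (K - K') := by rw [← hEF]; abel
  have h1' (x : B) : K' * (F * x) = q ^ 2 • (F * (K' * x)) := by
    rw [← mul_assoc, h1, smul_mul_assoc, mul_assoc]
  have h2' (x : B) : E * (K' * x) = q ^ 2 • (K' * (E * x)) := by
    rw [← mul_assoc, h2, smul_mul_assoc, mul_assoc]
  have h4' (x : B) : E * (F * x) = F * (E * x) + (q - q⁻¹)⁻¹ • (K * x - K' * x) := by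
    rw [← mul_assoc, h4, add_mul, mul_assoc, smul_mul_assoc, sub_mul]
  have h5' (x : B) : K * (K' * x) = x := by rw [← mul_assoc, hKK', one_mul]
  have h6' (x : B) : K' * (K * x) = x := by rw [← mul_assoc, hK'K, one_mul]
  have h7 : E * K = q⁻¹ ^ 2 • (K * E) := by
    rw [(conj_eq_iff_mul_eq hKK' hK'K).1 hKE, smul_mul_assoc, smul_smul, ← mul_pow,
      inv_mul_cancel₀ hq, one_pow, one_smul]
  have hq2 : q ^ 2 - 1 ≠ 0 := by
    intro h; apply hγ; field_simp; linear_combination h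
  subst ha hb hc hd
  refine ⟨?_, ?_, ?_, ?_, ?_, ?_, ?_⟩ <;>
  simp only [add_mul, mul_add, mul_sub, smul_mul_assoc, mul_smul_comm, mul_assoc, h1, h2,
    h3, h4, h1', h2', h4', h5', h6', h7, hKK', hK'K, smul_add, smul_sub] <;>
  match_scalars <;> field_simp <;> ring

end Relations

section WeightModule

variable (k : Type*) {S : Type*} [Field k] [CommRing S] [Algebra k S]

/-- The operator on functions `ℤ → S` that shifts by `m` and multiplies by `φ`. -/
def weightedShift (φ : ℤ → S) (m : ℤ) : Module.End k (ℤ → S) where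
  toFun f n := φ n * f (n + m)
  map_add' f g := by ext n; simp [mul_add]
  map_smul' t f := by ext n; simp

variable {k}

@[simp]
lemma weightedShift_apply (φ : ℤ → S) (m : ℤ) (f : ℤ → S) (n : ℤ) :
    weightedShift k φ m f n = φ n * f (n + m) := rfl

lemma weightedShift_mul (φ ψ : ℤ → S) (m l : ℤ) :
    weightedShift k φ m * weightedShift k ψ l =
      weightedShift k (fun n ↦ φ n * ψ (n + m)) (m + l) := by
  ext f n
  simp [mul_assoc, add_assoc]

lemma weightedShift_single (φ : ℤ → S) (m n : ℤ) (s : S) :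
    weightedShift k φ m (Pi.single n s) = Pi.single (n - m) (φ (n - m) * s) := by
  ext l
  by_cases h : l = n - m
  · subst h; simp
  · have h' : l + m ≠ n := fun h' ↦ h (by omega)
    simp [h, h']

lemma linearIndependent_gwaMonomial_apply [IsDomain S] {u v : S}
    {s : ℤ → S} (hs : ∀ n, s n ≠ 0)
    (huv : LinearIndependent k fun x : ℕ × ℕ ↦ u ^ x.1 * v ^ x.2) :
    LinearIndependent k fun x : (Σ _ : ℤ, ℕ × ℕ) ↦
      (Pi.single x.1 (s x.1 * (u ^ x.2.1 * v ^ x.2.2)) : ℤ → S) :=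
  Pi.linearIndependent_single (fun n (x : ℕ × ℕ) ↦ s n * (u ^ x.1 * v ^ x.2)) fun n ↦
    huv.map' (LinearMap.mulLeft k (s n))
      (LinearMap.ker_eq_bot.2 (mul_right_injective₀ (hs n)))

variable {A : Type*} [Ring A] [Algebra k A]

lemma signedPow_apply_single {b c : A} {ρ : A →ₐ[k] Module.End k (ℤ → S)} [IsDomain S]
    {β γ : ℤ → S} (hβ : ∀ n, β n ≠ 0) (hγ : ∀ n, γ n ≠ 0)
    (hb : ∀ n s, ρ b (Pi.single n s) = Pi.single (n + 1) (β n * s))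
    (hc : ∀ n s, ρ c (Pi.single n s) = Pi.single (n - 1) (γ n * s)) (n : ℤ) :
    ∃ t : S, t ≠ 0 ∧ ∀ s, ρ (signedPow b c n) (Pi.single 0 s) = Pi.single n (t * s) := by
  obtain ⟨m, rfl | rfl⟩ := n.eq_nat_or_neg
  · change ∃ t : S, t ≠ 0 ∧ ∀ s, ρ (b ^ m) _ = _
    induction m with
    | zero => exact ⟨1, one_ne_zero, by simp⟩
    | succ m ih =>
      obtain ⟨t, ht, h⟩ := ih
      refine ⟨β m * t, mul_ne_zero (hβ m) ht, fun s ↦ ?_⟩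
      rw [pow_succ', map_mul, Module.End.mul_apply, h, hb, mul_assoc, Nat.cast_succ]
  · rw [signedPow_neg_natCast]
    induction m with
    | zero => exact ⟨1, one_ne_zero, by simp⟩
    | succ m ih =>
      obtain ⟨t, ht, h⟩ := ih
      refine ⟨γ (-m) * t, mul_ne_zero (hγ _) ht, fun s ↦ ?_⟩
      rw [pow_succ', map_mul, Module.End.mul_apply, h, hc, mul_assoc, Nat.cast_succ, neg_add']

lemma pow_apply_single {a : A} {ρ : A →ₐ[k] Module.End k (ℤ → S)} {n : ℤ} {u : S}
    (ha : ∀ s, ρ a (Pi.single n s) = Pi.single n (u * s)) (i : ℕ) (s : S) :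
    ρ (a ^ i) (Pi.single n s) = Pi.single n (u ^ i * s) := by
  induction i with
  | zero => simp
  | succ i ih => rw [pow_succ', map_mul, Module.End.mul_apply, ih, ha, pow_succ', mul_assoc]

/-- A representation by weighted shifts with algebraically independent weights is faithful. -/
lemma injective_of_weight_action {b c w d : A} {ρ : A →ₐ[k] Module.End k (ℤ → S)} [IsDomain S]
    {β γ : ℤ → S} {u v : S}
    (htop : Submodule.span k (Set.range (gwaMonomial b c w d)) = ⊤)
    (hβ : ∀ n, β n ≠ 0) (hγ : ∀ n, γ n ≠ 0)
    (hb : ∀ n s, ρ b (Pi.single n s) = Pi.single (n + 1) (β n * s))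
    (hc : ∀ n s, ρ c (Pi.single n s) = Pi.single (n - 1) (γ n * s))
    (hw : ∀ s, ρ w (Pi.single 0 s) = Pi.single 0 (u * s))
    (hd : ∀ s, ρ d (Pi.single 0 s) = Pi.single 0 (v * s))
    (huv : LinearIndependent k fun x : ℕ × ℕ ↦ u ^ x.1 * v ^ x.2) :
    Function.Injective ρ := by
  choose t ht h using signedPow_apply_single (ρ := ρ) hβ hγ hb hc
  let ψ : A →ₗ[k] (ℤ → S) := (LinearMap.applyₗ (Pi.single 0 1)).comp ρ.toLinearMap
  have hψ : LinearIndependent k (ψ ∘ gwaMonomial b c w d) := by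
    convert linearIndependent_gwaMonomial_apply ht huv using 2 with x
    simp only [ψ, gwaMonomial, Function.comp_apply, LinearMap.comp_apply, AlgHom.toLinearMap_apply,
      LinearMap.applyₗ_apply_apply, map_mul, Module.End.mul_apply]
    rw [pow_apply_single hd, pow_apply_single hw, h, mul_one]
  rw [injective_iff_map_eq_zero]
  intro x hx
  obtain ⟨l, rfl⟩ := (Finsupp.mem_span_range_iff_exists_finsupp).1
    (htop ▸ Submodule.mem_top : x ∈ Submodule.span k (Set.range (gwaMonomial b c w d)))
  have hl : Finsupp.linearCombination k (ψ ∘ gwaMonomial b c w d) l = 0 := by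
    rw [← Finsupp.apply_linearCombination]
    change ρ (l.sum fun i a ↦ a • gwaMonomial b c w d i) _ = 0
    rw [hx, LinearMap.zero_apply]
  rw [linearIndependent_iff.1 hψ l hl, Finsupp.sum_zero_index]

end WeightModule

section LinearIndependence

variable {k : Type*} [Field k]

lemma Transcendental.linearIndependent_pow {L : Type*} [CommRing L] [Algebra k L] {x : L}
    (hx : Transcendental k x) : LinearIndependent k fun n : ℕ ↦ x ^ n := by
  have := (Polynomial.basisMonomials k).linearIndependent.map'
    (Polynomial.aeval x).toLinearMap
    (LinearMap.ker_eq_bot.2 (transcendental_iff_injective.1 hx))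
  simpa [Function.comp_def] using this

lemma linearIndependent_X_pow_mul_C_pow {L : Type*} [Field L] [Algebra k L] {x : L}
    (hx : Transcendental k x) :
    LinearIndependent k fun n : ℕ × ℕ ↦
      (Polynomial.X ^ n.1 * Polynomial.C x ^ n.2 : Polynomial L) := by
  have h := linearIndependent_smul hx.linearIndependent_pow
    (Polynomial.basisMonomials L).linearIndependent
  rw [← linearIndependent_equiv (Equiv.prodComm ℕ ℕ)] at h
  convert h using 2 with n
  simp [Polynomial.smul_eq_C_mul, mul_comm, Polynomial.X_pow_eq_monomial]

end LinearIndependence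

section Presentations

lemma qv_ne_zero : qv ≠ 0 := RatFunc.X_ne_zero

lemma qv_sub_inv_ne_zero : qv - qv⁻¹ ≠ 0 := by
  intro h
  have h2 : qv ^ 2 = 1 := by
    have := qv_ne_zero
    field_simp at h
    linear_combination h
  refine RatFunc.transcendental_X (K := ℂ) ⟨Polynomial.X ^ 2 - 1, ?_, ?_⟩
  · exact Polynomial.X_pow_sub_C_ne_zero two_pos (1 : ℂ)
  · simpa [sub_eq_zero] using (show (RatFunc.X : RatFunc ℂ) ^ 2 = 1 from h2)

lemma aA_eq : aA = qv⁻¹ • ωA - qv⁻¹ ^ 2 • dA := eq_smul_sub_smul_of_eq qv_ne_zero rfl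

lemma aA_mul_dA : aA * dA = dA * aA := by
  simpa [aA, dA] using RingQuot.mkAlgHom_rel Kq ARel.ad_comm

lemma dA_mul_bA : dA * bA = qv ^ 2 • (bA * dA) := by
  simpa [dA, bA] using RingQuot.mkAlgHom_rel Kq ARel.db

lemma cA_mul_dA : cA * dA = qv ^ 2 • (dA * cA) := by
  simpa [dA, cA] using RingQuot.mkAlgHom_rel Kq ARel.cd

lemma aA_mul_bA_sub : aA * bA - bA * aA = (-(1 - qv⁻¹ ^ 2)) • (bA * dA) := by
  simpa only [aA, bA, cA, dA, map_sub, map_mul, map_smul] using RingQuot.mkAlgHom_rel Kq ARel.ab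

lemma cA_mul_bA_sub : cA * bA - bA * cA = (1 - qv⁻¹ ^ 2) • (dA * aA - dA * dA) := by
  simpa only [aA, bA, cA, dA, map_sub, map_mul, map_smul] using RingQuot.mkAlgHom_rel Kq ARel.cb

lemma aA_mul_cA_sub : aA * cA - cA * aA = (1 - qv⁻¹ ^ 2) • (dA * cA) := by
  simpa only [aA, bA, cA, dA, map_sub, map_mul, map_smul] using RingQuot.mkAlgHom_rel Kq ARel.ac

lemma aA_mul_dA_sub : aA * dA - qv ^ 2 • (bA * cA) = 1 := by
  simpa only [aA, bA, cA, dA, map_sub, map_mul, map_smul, map_one] using RingQuot.mkAlgHom_rel Kq ARel.det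

lemma ωA_mul_dA : ωA * dA = dA * ωA := by
  simp [ωA, add_mul, mul_add, aA_mul_dA]

lemma ωA_mul_bA : ωA * bA = bA * ωA :=
  smul_add_smul_inv_mul_comm qv_ne_zero dA_mul_bA aA_mul_bA_sub

lemma ωA_mul_cA : ωA * cA = cA * ωA :=
  smul_add_smul_inv_mul_comm' qv_ne_zero cA_mul_dA aA_mul_cA_sub

lemma dA_mul_cA : dA * cA = qv⁻¹ ^ 2 • (cA * dA) := by
  rw [cA_mul_dA, smul_smul, ← mul_pow, inv_mul_cancel₀ qv_ne_zero, one_pow, one_smul]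

lemma Kel_mul_Kinvel : Kel * Kinvel = 1 := by
  simpa only [Kel, Kinvel, map_mul, map_one] using RingQuot.mkAlgHom_rel Kq URel.KKinv

lemma Kinvel_mul_Kel : Kinvel * Kel = 1 := by
  simpa only [Kel, Kinvel, map_mul, map_one] using RingQuot.mkAlgHom_rel Kq URel.KinvK

lemma Kel_mul_Eel_mul_Kinvel : Kel * Eel * Kinvel = qv ^ 2 • Eel := by
  simpa only [Kel, Eel, Kinvel, map_mul, map_smul] using RingQuot.mkAlgHom_rel Kq URel.KE

lemma Kel_mul_Fel_mul_Kinvel : Kel * Fel * Kinvel = qv⁻¹ ^ 2 • Fel := by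
  simpa only [Kel, Fel, Kinvel, map_mul, map_smul] using RingQuot.mkAlgHom_rel Kq URel.KF

lemma Eel_mul_Fel_sub : Eel * Fel - Fel * Eel = (qv - qv⁻¹)⁻¹ • (Kel - Kinvel) := by
  simpa only [Eel, Fel, Kel, Kinvel, map_sub, map_mul, map_smul]
    using RingQuot.mkAlgHom_rel Kq URel.EF

lemma exists_algHom_Uq {B : Type*} [Ring B] [Algebra Kq B] {E F K K' : B}
    (hKK' : K * K' = 1) (hK'K : K' * K = 1) (hKE : K * E * K' = qv ^ 2 • E)
    (hKF : K * F * K' = qv⁻¹ ^ 2 • F) (hEF : E * F - F * E = (qv - qv⁻¹)⁻¹ • (K - K')) :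
    ∃ φ : Uq →ₐ[Kq] B, φ Eel = E ∧ φ Fel = F ∧ φ Kel = K ∧ φ Kinvel = K' := by
  let g : UGen → B := fun | .E => E | .F => F | .K => K | .Kinv => K'
  refine ⟨RingQuot.liftAlgHom Kq ⟨FreeAlgebra.lift Kq g, fun x y h ↦ ?_⟩, ?_⟩
  · cases h <;> simpa only [map_mul, map_sub, map_smul, map_one, FreeAlgebra.lift_ι_apply]
  · simp [Eel, Fel, Kel, Kinvel, g, RingQuot.liftAlgHom_mkAlgHom_apply]

lemma exists_algHom_Aalg {B : Type*} [Ring B] [Algebra Kq B] {a b c d : B}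
    (had : a * d = d * a) (hdb : d * b = qv ^ 2 • (b * d)) (hcd : c * d = qv ^ 2 • (d * c))
    (hab : a * b - b * a = (-(1 - qv⁻¹ ^ 2)) • (b * d))
    (hcb : c * b - b * c = (1 - qv⁻¹ ^ 2) • (d * a - d * d))
    (hac : a * c - c * a = (1 - qv⁻¹ ^ 2) • (d * c))
    (hdet : a * d - qv ^ 2 • (b * c) = 1) :
    ∃ φ : Aalg →ₐ[Kq] B, φ aA = a ∧ φ bA = b ∧ φ cA = c ∧ φ dA = d := by
  let g : AGen → B := fun | .a => a | .b => b | .c => c | .d => d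
  refine ⟨RingQuot.liftAlgHom Kq ⟨FreeAlgebra.lift Kq g, fun x y h ↦ ?_⟩, ?_⟩
  · cases h <;> simpa only [map_mul, map_sub, map_smul, map_one, FreeAlgebra.lift_ι_apply]
  · simp [aA, bA, cA, dA, g, RingQuot.liftAlgHom_mkAlgHom_apply]

lemma Aalg_algHom_ext {B : Type*} [Ring B] [Algebra Kq B] {φ ψ : Aalg →ₐ[Kq] B}
    (ha : φ aA = ψ aA) (hb : φ bA = ψ bA) (hc : φ cA = ψ cA) (hd : φ dA = ψ dA) : φ = ψ := by
  refine RingQuot.ringQuot_ext' _ _ _ (FreeAlgebra.hom_ext (funext fun x ↦ ?_))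
  cases x <;> assumption

lemma adjoin_Aalg_eq_top : Algebra.adjoin Kq {ωA, bA, cA, dA} = ⊤ := by
  set T : Subalgebra Kq Aalg := Algebra.adjoin Kq {ωA, bA, cA, dA} with hT
  have hω : ωA ∈ T := Algebra.subset_adjoin (by simp)
  have hb : bA ∈ T := Algebra.subset_adjoin (by simp)
  have hc : cA ∈ T := Algebra.subset_adjoin (by simp)
  have hd : dA ∈ T := Algebra.subset_adjoin (by simp)
  have ha : aA ∈ T := by
    rw [aA_eq]
    exact sub_mem (T.smul_mem hω _) (T.smul_mem hd _)
  have h : Algebra.adjoin Kq (Set.range (FreeAlgebra.ι Kq)) ≤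
      T.comap (RingQuot.mkAlgHom Kq ARel) := by
    refine Algebra.adjoin_le ?_
    rintro _ ⟨x, rfl⟩
    cases x <;> assumption
  rw [FreeAlgebra.adjoin_range_ι] at h
  refine eq_top_iff.2 fun x _ ↦ ?_
  obtain ⟨y, rfl⟩ := RingQuot.mkAlgHom_surjective Kq ARel x
  exact h (Algebra.mem_top : y ∈ ⊤)

lemma span_gwaMonomial_Aalg :
    Submodule.span Kq (Set.range (gwaMonomial bA cA ωA dA)) = ⊤ :=
  span_range_gwaMonomial_eq_top dA_mul_bA dA_mul_cA ωA_mul_bA ωA_mul_cA ωA_mul_dA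
    (mul_eq_of_det qv_ne_zero rfl aA_mul_dA_sub)
    (mul_eq_of_mul_sub qv_ne_zero rfl aA_mul_dA cA_mul_bA_sub aA_mul_dA_sub)
    adjoin_Aalg_eq_top

end Presentations

section GenericWeights

open Polynomial

variable {k L : Type*} [Field k] [Field L] [Algebra k L]

/-- The weight of `K⁻¹` on the `n`-th basis vector of the generic weight module. -/
def invWeight (q : k) (x : L) (n : ℤ) : L := x * algebraMap k L q ^ (2 * n)

/-- The weight of `F E` on the `n`-th basis vector of the generic weight module. -/
def casimirWeight (q : k) (x : L) (n : ℤ) : L[X] :=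
  ((q - q⁻¹) ^ 2)⁻¹ • (X - C (q • (invWeight q x n)⁻¹ + q⁻¹ • invWeight q x n))

lemma invWeight_ne_zero {q : k} (hq : q ≠ 0) {x : L} (hx : x ≠ 0) (n : ℤ) :
    invWeight q x n ≠ 0 :=
  mul_ne_zero hx (zpow_ne_zero _ (by simpa using hq))

lemma invWeight_add_one {q : k} (hq : q ≠ 0) (x : L) (n : ℤ) :
    invWeight q x (n + 1) = q ^ 2 • invWeight q x n := by
  have : algebraMap k L q ≠ 0 := by simpa using hq
  rw [invWeight, invWeight, mul_add, zpow_add₀ this, Algebra.smul_def, map_pow, mul_one, ← mul_assoc,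
    mul_comm, ← zpow_natCast, Nat.cast_ofNat]

lemma casimirWeight_ne_zero {q : k} (hγ : q - q⁻¹ ≠ 0) (x : L) (n : ℤ) :
    casimirWeight q x n ≠ 0 :=
  smul_ne_zero (inv_ne_zero (pow_ne_zero 2 hγ)) (X_sub_C_ne_zero _)

lemma casimirWeight_add_one_sub {q : k} (hq : q ≠ 0) (hγ : q - q⁻¹ ≠ 0) {x : L} (hx : x ≠ 0)
    (n : ℤ) :
    casimirWeight q x (n + 1) - casimirWeight q x n =
      (q - q⁻¹)⁻¹ • (C (invWeight q x n)⁻¹ - C (invWeight q x n)) := by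
  have hn := invWeight_ne_zero hq hx n
  have hq2 : q ^ 2 - 1 ≠ 0 := by
    intro h; apply hγ; field_simp; linear_combination h
  have hinv : (q ^ 2 • invWeight q x n)⁻¹ = (q ^ 2)⁻¹ • (invWeight q x n)⁻¹ := by
    simp only [Algebra.smul_def, mul_inv, map_inv₀]
  rw [casimirWeight, casimirWeight, invWeight_add_one hq, hinv]
  simp only [smul_smul, C_add, ← smul_C]
  match_scalars <;> field_simp <;> ring

lemma smul_casimirWeight_add {q : k}
    (hγ : q - q⁻¹ ≠ 0) (x : L) (n : ℤ) :
    (q - q⁻¹) ^ 2 • casimirWeight q x n + q • C (invWeight q x n)⁻¹ + q⁻¹ • C (invWeight q x n)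
      = X := by
  rw [casimirWeight, smul_inv_smul₀ (pow_ne_zero 2 hγ), C_add, smul_C, smul_C]
  ring

end GenericWeights

section Faithfulness

open Polynomial

variable {L : Type*} [Field L] [Algebra Kq L]

lemma exists_weight_representation {x : L} (hx : x ≠ 0) :
    ∃ ρ : Uq →ₐ[Kq] Module.End Kq (ℤ → L[X]),
      ρ Eel = weightedShift Kq (fun n ↦ casimirWeight qv x (n + 1)) 1 ∧
      ρ Fel = weightedShift Kq 1 (-1) ∧
      ρ Kel = weightedShift Kq (fun n ↦ C (invWeight qv x n)⁻¹) 0 ∧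
      ρ Kinvel = weightedShift Kq (fun n ↦ C (invWeight qv x n)) 0 := by
  have hn := invWeight_ne_zero qv_ne_zero hx
  have hs := invWeight_add_one qv_ne_zero x
  have hC (n : ℤ) : C (invWeight qv x n)⁻¹ * C (invWeight qv x n) = 1 := by
    rw [← C_mul, inv_mul_cancel₀ (hn n), C_1]
  have hs' (n : ℤ) : C (invWeight qv x n)⁻¹ * C (invWeight qv x (n + 1)) = qv ^ 2 • 1 := by
    rw [hs, ← smul_C, mul_smul_comm, hC]
  have hs'' (n : ℤ) : C (invWeight qv x (n + 1))⁻¹ * C (invWeight qv x n) = qv⁻¹ ^ 2 • 1 := by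
    rw [inv_pow, eq_inv_smul_iff₀ (pow_ne_zero 2 qv_ne_zero), ← mul_smul_comm, smul_C, ← hs, hC]
  refine exists_algHom_Uq ?_ ?_ ?_ ?_ ?_
  · rw [weightedShift_mul]
    ext f n : 2
    simp only [weightedShift_apply, add_zero, Module.End.one_apply, hC, one_mul]
  · rw [weightedShift_mul]
    ext f n : 2
    simp only [weightedShift_apply, add_zero, Module.End.one_apply, mul_comm (C (invWeight _ _ _)),
      hC, one_mul]
  · rw [weightedShift_mul, weightedShift_mul]
    ext f n : 2
    simp only [weightedShift_apply, LinearMap.smul_apply, Pi.smul_apply, add_zero, zero_add]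
    rw [mul_right_comm (C _), hs', smul_mul_assoc, smul_mul_assoc, one_mul]
  · rw [weightedShift_mul, weightedShift_mul]
    ext f n : 2
    simp only [weightedShift_apply, LinearMap.smul_apply, Pi.smul_apply, add_zero, zero_add,
      Pi.one_apply, mul_one, one_mul]
    obtain ⟨m, rfl⟩ : ∃ m, n = m + 1 := ⟨n - 1, by ring⟩
    rw [add_neg_cancel_right, hs'', smul_mul_assoc, one_mul]
  · rw [weightedShift_mul, weightedShift_mul]
    ext f n : 2
    have := casimirWeight_add_one_sub qv_ne_zero qv_sub_inv_ne_zero hx n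
    simp only [weightedShift_apply, LinearMap.smul_apply, LinearMap.sub_apply, Pi.sub_apply,
      Pi.smul_apply, add_zero, Pi.one_apply, mul_one, one_mul, add_neg_cancel, neg_add_cancel,
      neg_add_cancel_right]
    rw [← sub_mul, ← sub_mul, this, smul_mul_assoc]

lemma injective_of_transcendental {x : L} (hx : Transcendental Kq x) {Φ : Aalg →ₐ[Kq] Uq}
    (ha : Φ aA = Kel + (qv⁻¹ * (qv - qv⁻¹) ^ 2) • (Fel * Eel))
    (hb : Φ bA = (qv⁻¹ * (qv - qv⁻¹)) • Fel) (hc : Φ cA = (qv - qv⁻¹) • (Kinvel * Eel))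
    (hd : Φ dA = Kinvel) : Function.Injective Φ := by
  have hq := qv_ne_zero
  have hγ := qv_sub_inv_ne_zero
  have hx0 : x ≠ 0 := by
    rintro rfl
    exact hx isAlgebraic_zero
  obtain ⟨ρ, hE, hF, hK, hK'⟩ := exists_weight_representation hx0
  have hn := invWeight_ne_zero hq hx0
  have h0 : invWeight qv x 0 = x := by simp [invWeight]
  refine Function.Injective.of_comp (f := ρ) (g := Φ) ?_
  rw [← AlgHom.coe_comp]
  refine injective_of_weight_action (u := X) (v := C x) span_gwaMonomial_Aalg
    (β := fun _ ↦ (qv⁻¹ * (qv - qv⁻¹)) • 1)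
    (γ := fun n ↦ (qv - qv⁻¹) •
      (C (invWeight qv x (n - 1)) * casimirWeight qv x n))
    (fun n ↦ smul_ne_zero (mul_ne_zero (inv_ne_zero hq) hγ) one_ne_zero)
    (fun n ↦ smul_ne_zero hγ (mul_ne_zero (C_ne_zero.2 (hn _)) (casimirWeight_ne_zero hγ _ _)))
    ?_ ?_ ?_ ?_ (linearIndependent_X_pow_mul_C_pow hx)
  · intro n s
    rw [AlgHom.comp_apply, hb, map_smul, hF, LinearMap.smul_apply, weightedShift_single,
      sub_neg_eq_add, Pi.one_apply, one_mul, smul_mul_assoc, one_mul, Pi.single_smul]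
  · intro n s
    rw [AlgHom.comp_apply, hc, map_smul, map_mul, hE, hK', LinearMap.smul_apply,
      Module.End.mul_apply, weightedShift_single, weightedShift_single, sub_zero,
      sub_add_cancel, smul_mul_assoc, mul_assoc, Pi.single_smul]
  · intro s
    rw [AlgHom.comp_apply, ωA, map_add, map_smul, map_smul, ha, hd, map_add, map_smul, map_smul,
      map_add, map_smul, map_mul, hE, hF, hK, hK']
    simp only [LinearMap.add_apply, LinearMap.smul_apply, Module.End.mul_apply,
      weightedShift_single, sub_zero, zero_sub, sub_neg_eq_add, neg_add_cancel, Pi.one_apply,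
      one_mul, ← Pi.single_smul, ← Pi.single_add]
    rw [← smul_casimirWeight_add hγ x 0, smul_add, smul_smul,
      mul_inv_cancel_left₀ hq, add_mul, add_mul, smul_mul_assoc, smul_mul_assoc, smul_mul_assoc]
    congr 1
    abel
  · intro s
    rw [AlgHom.comp_apply, hd, hK', weightedShift_single, sub_zero, h0]

end Faithfulness

/-- There is a unique `ℂ(q)`-algebra homomorphism `Φ₁ : 𝒜 → U_q` with
`Φ₁(a) = K + q⁻¹(q - q⁻¹)² F E`, `Φ₁(b) = q⁻¹(q - q⁻¹) F`, `Φ₁(c) = (q - q⁻¹) K⁻¹ E`,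
`Φ₁(d) = K⁻¹`, and this homomorphism is injective. -/
theorem statement1 :
    (∃! Φ : Aalg →ₐ[Kq] Uq,
        Φ aA = Kel + (qv⁻¹ * (qv - qv⁻¹) ^ 2) • (Fel * Eel)
        ∧ Φ bA = (qv⁻¹ * (qv - qv⁻¹)) • Fel
        ∧ Φ cA = (qv - qv⁻¹) • (Kinvel * Eel)
        ∧ Φ dA = Kinvel)
    ∧ ∀ Φ : Aalg →ₐ[Kq] Uq,
        Φ aA = Kel + (qv⁻¹ * (qv - qv⁻¹) ^ 2) • (Fel * Eel) →
        Φ bA = (qv⁻¹ * (qv - qv⁻¹)) • Fel →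
        Φ cA = (qv - qv⁻¹) • (Kinvel * Eel) →
        Φ dA = Kinvel →
        Function.Injective Φ := by
  have hq := qv_ne_zero
  have hγ := qv_sub_inv_ne_zero
  refine ⟨existsUnique_of_exists_of_unique ?_ ?_, ?_⟩
  · obtain ⟨h1, h2, h3, h4, h5, h6, h7⟩ := exists_quantum_relations hq hγ Kel_mul_Kinvel
      Kinvel_mul_Kel Kel_mul_Eel_mul_Kinvel Kel_mul_Fel_mul_Kinvel Eel_mul_Fel_sub rfl rfl rfl rfl
    exact exists_algHom_Aalg h1 h2 h3 h4 h5 h6 h7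
  · rintro φ ψ ⟨h1, h2, h3, h4⟩ ⟨h1', h2', h3', h4'⟩
    exact Aalg_algHom_ext (h1.trans h1'.symm) (h2.trans h2'.symm) (h3.trans h3'.symm)
      (h4.trans h4'.symm)
  · intro Φ ha hb hc hd
    exact injective_of_transcendental RatFunc.transcendental_X ha hb hc hd
end
end
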